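/- Let D be a nonzero derivation of the monoid algebra A(C) that is homogeneous of degree μ ∈ M, i.e., D(f_λ) ∈ K·f_{λ+μ} for all λ ∈ Γ(C) (with the convention that f_{λ+μ} = 0 if λ + μ ∉ Γ(C)). If D is locally nilpotent, then μ is a Demazure root of C, i.e., there exists a primitive ray generator ρ of C with ⟨ρ, μ⟩ = -1 and ⟨ρ', μ⟩ ≥ 0 for all other primitive ray generators ρ'. -/

import Mathlib

def dotZ {d : ℕ} (v w : Fin d → ℤ) : ℤ := ∑ i, v i * w i

def dotQ {d : ℕ} (x : Fin d → ℚ) (w : Fin d → ℤ) : ℚ := ∑ i, x i * (w i : ℚ)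

def toQ {d : ℕ} (v : Fin d → ℤ) : Fin d → ℚ := fun i => (v i : ℚ)

/-- `C` is the convex cone generated by the finite set `S` of lattice points. -/
def IsConeOf {d : ℕ} (C : Set (Fin d → ℚ)) (S : Finset (Fin d → ℤ)) : Prop :=
  C = {x | ∃ c : (Fin d → ℤ) → ℚ, (∀ v, 0 ≤ c v) ∧ x = ∑ v ∈ S, c v • toQ v}

/-- A cone is strictly convex if it contains no line. -/
def StrictConvexCone {d : ℕ} (C : Set (Fin d → ℚ)) : Prop :=
  ∀ x ∈ C, -x ∈ C → x = 0

def OnRay {d : ℕ} (ρ : Fin d → ℤ) (x : Fin d → ℚ) : Prop :=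
  ∃ q : ℚ, 0 ≤ q ∧ x = q • toQ ρ

/-- `ρ` is a primitive lattice generator of an extremal ray (a one-dimensional face) of `C`. -/
def IsPrimRayGen {d : ℕ} (C : Set (Fin d → ℚ)) (ρ : Fin d → ℤ) : Prop :=
  (∀ (k : ℤ) (w : Fin d → ℤ), ρ = k • w → IsUnit k) ∧ toQ ρ ∈ C ∧
    ∀ x ∈ C, ∀ y ∈ C, OnRay ρ (x + y) → OnRay ρ x

/-- `μ` is a Demazure root of `C` with respect to the primitive ray generator `ρ`. -/
def IsDemazureRoot {d : ℕ} (C : Set (Fin d → ℚ)) (ρ μ : Fin d → ℤ) : Prop :=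
  IsPrimRayGen C ρ ∧ dotZ ρ μ = -1 ∧
    ∀ ρ' : Fin d → ℤ, IsPrimRayGen C ρ' → ρ' ≠ ρ → 0 ≤ dotZ ρ' μ

/-- The dual monoid `Γ(C) = {λ ∈ M ∣ ⟨x, λ⟩ ≥ 0 for all x ∈ C}`. -/
def GammaC {d : ℕ} (C : Set (Fin d → ℚ)) : AddSubmonoid (Fin d → ℤ) where
  carrier := {lam | ∀ x ∈ C, 0 ≤ dotQ x lam}
  zero_mem' := by intro x hx; simp [dotQ]
  add_mem' := by
    intro a b ha hb x hx
    have h1 := ha x hx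
    have h2 := hb x hx
    have h : dotQ x (a + b) = dotQ x a + dotQ x b := by
      unfold dotQ
      rw [← Finset.sum_add_distrib]
      refine Finset.sum_congr rfl fun i _ => ?_
      push_cast [Pi.add_apply]
      ring
    rw [h]
    linarith

open Finset in
theorem farkasQ {ι V : Type*} [AddCommGroup V] [Module ℚ V] (s : Finset ι) :
    ∀ (f : ι → V →ₗ[ℚ] ℚ) (g : V →ₗ[ℚ] ℚ),
      (∀ w, (∀ i ∈ s, 0 ≤ f i w) → 0 ≤ g w) →
      ∃ c : ι → ℚ, (∀ i, 0 ≤ c i) ∧ g = ∑ i ∈ s, c i • f i := by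
  classical
  induction s using Finset.induction_on with
  | empty =>
    intro f g h
    refine ⟨0, fun _ => le_rfl, ?_⟩
    ext w
    have h1 := h w (by simp)
    have h2 := h (-w) (by simp)
    simp at h2 ⊢
    linarith
  | insert a s ha ih =>
    intro f g h
    by_cases hg : ∀ w, (∀ i ∈ s, 0 ≤ f i w) → 0 ≤ g w
    · obtain ⟨c, hc, hgc⟩ := ih f g hg
      refine ⟨fun i => if i = a then 0 else c i, ?_, ?_⟩
      · intro i
        dsimp only
        split_ifs
        · exact le_rfl
        · exact hc i
      · rw [sum_insert ha, hgc]
        simp only [if_true, zero_smul, zero_add]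
        refine sum_congr rfl fun i hi => ?_
        rw [if_neg (ne_of_mem_of_not_mem hi ha)]
    · push Not at hg
      obtain ⟨w0, hw0, hgw0⟩ := hg
      have hfa : f a w0 < 0 := by
        by_contra hcon
        push Not at hcon
        have := h w0 (by
          intro i hi
          rcases mem_insert.1 hi with rfl | hi
          · exact hcon
          · exact hw0 i hi)
        linarith
      set t : ℚ := -(f a w0) with ht
      have htp : 0 < t := by linarith
      obtain ⟨c, hc, hgc⟩ := ih (fun i => f i + (f i w0 / t) • f a) (g + (g w0 / t) • f a) (by
        intro w hw
        have := h (w + (f a w / t) • w0) (by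
          intro i hi
          rcases mem_insert.1 hi with rfl | hi
          · have : f i w + f i w / t * f i w0 = 0 := by
              have : f i w0 = - t := by simp [ht]
              rw [this]; field_simp; ring
            simp [this]
          · have := hw i hi
            simp at this ⊢
            exact this.trans (le_of_eq (by ring)))
        simp at this ⊢
        exact this.trans (le_of_eq (by ring)))
      refine ⟨fun i => if i = a then ∑ j ∈ s, c j * (f j w0 / t) - g w0 / t else c i, ?_, ?_⟩
      · intro i
        dsimp only
        split_ifs
        · have h1 : 0 ≤ ∑ j ∈ s, c j * (f j w0 / t) :=
            sum_nonneg fun j hj => mul_nonneg (hc j) (div_nonneg (hw0 j hj) htp.le)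
          have h2 : g w0 / t < 0 := div_neg_of_neg_of_pos hgw0 htp
          linarith
        · exact hc i
      · rw [sum_insert ha]
        have e : ∑ i ∈ s, (if i = a then ∑ j ∈ s, c j * (f j w0 / t) - g w0 / t else c i) • f i
            = ∑ i ∈ s, c i • f i := by
          refine sum_congr rfl fun i hi => ?_
          rw [if_neg (ne_of_mem_of_not_mem hi ha)]
        rw [e]
        simp only [if_true]
        simp only [smul_add, sum_add_distrib, smul_smul, ← sum_smul] at hgc
        rw [sub_smul]
        refine (eq_sub_of_add_eq hgc).trans ?_
        abel

theorem dotQ_toQ {d : ℕ} (v w : Fin d → ℤ) : dotQ (toQ v) w = (dotZ v w : ℚ) := by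
  simp [dotQ, toQ, dotZ]

theorem dotZ_add {d : ℕ} (v a b : Fin d → ℤ) : dotZ v (a + b) = dotZ v a + dotZ v b := by
  simp [dotZ, mul_add, Finset.sum_add_distrib]

theorem dotZ_smul {d : ℕ} (v : Fin d → ℤ) (k : ℤ) (b : Fin d → ℤ) :
    dotZ v (k • b) = k * dotZ v b := by
  simp only [dotZ, Finset.mul_sum, Pi.smul_apply, smul_eq_mul]
  exact Finset.sum_congr rfl fun i _ => by ring

theorem dotZ_nsmul {d : ℕ} (v : Fin d → ℤ) (k : ℕ) (b : Fin d → ℤ) :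
    dotZ v (k • b) = k * dotZ v b := by
  rw [← dotZ_smul]; simp

theorem smul_dotZ {d : ℕ} (v : Fin d → ℤ) (k : ℤ) (b : Fin d → ℤ) :
    dotZ (k • v) b = k * dotZ v b := by
  simp only [dotZ, Finset.mul_sum, Pi.smul_apply, smul_eq_mul]
  exact Finset.sum_congr rfl fun i _ => by ring

theorem dotZ_sub {d : ℕ} (v a b : Fin d → ℤ) : dotZ v (a - b) = dotZ v a - dotZ v b := by
  simp [dotZ, mul_sub, Finset.sum_sub_distrib]

theorem dotZ_sum {d : ℕ} {ι : Type*} (v : Fin d → ℤ) (s : Finset ι) (f : ι → Fin d → ℤ) :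
    dotZ v (∑ i ∈ s, f i) = ∑ i ∈ s, dotZ v (f i) := by
  classical
  induction s using Finset.induction_on with
  | empty => simp [dotZ]
  | insert a s ha ih => rw [Finset.sum_insert ha, Finset.sum_insert ha, dotZ_add, ih]

theorem dotQ_comb {d : ℕ} (S : Finset (Fin d → ℤ)) (c : (Fin d → ℤ) → ℚ) (m : Fin d → ℤ) :
    dotQ (∑ v ∈ S, c v • toQ v) m = ∑ v ∈ S, c v * (dotZ v m : ℚ) := by
  simp only [← dotQ_toQ, dotQ, Finset.sum_apply, Pi.smul_apply, smul_eq_mul, Finset.sum_mul,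
    Finset.mul_sum]
  rw [Finset.sum_comm]
  simp only [mul_assoc]

theorem gen_mem {d : ℕ} {C : Set (Fin d → ℚ)} {S : Finset (Fin d → ℤ)} (hC : IsConeOf C S)
    {v : Fin d → ℤ} (hv : v ∈ S) : toQ v ∈ C := by
  classical
  rw [hC]
  refine ⟨fun u => if u = v then 1 else 0, fun u => by dsimp only; split_ifs <;> simp, ?_⟩
  simp [hv]

theorem cone_add {d : ℕ} {C : Set (Fin d → ℚ)} {S : Finset (Fin d → ℤ)} (hC : IsConeOf C S)
    {x y : Fin d → ℚ} (hx : x ∈ C) (hy : y ∈ C) : x + y ∈ C := by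
  rw [hC] at *
  obtain ⟨a, ha, rfl⟩ := hx
  obtain ⟨b, hb, rfl⟩ := hy
  exact ⟨a + b, fun v => add_nonneg (ha v) (hb v), by simp [add_smul, Finset.sum_add_distrib]⟩

theorem cone_smul {d : ℕ} {C : Set (Fin d → ℚ)} {S : Finset (Fin d → ℤ)} (hC : IsConeOf C S)
    {x : Fin d → ℚ} {q : ℚ} (hq : 0 ≤ q) (hx : x ∈ C) : q • x ∈ C := by
  rw [hC] at *
  obtain ⟨a, ha, rfl⟩ := hx
  exact ⟨fun v => q * a v, fun v => mul_nonneg hq (ha v), by simp [Finset.smul_sum, smul_smul]⟩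

theorem cone_sum {d : ℕ} {C : Set (Fin d → ℚ)} {S : Finset (Fin d → ℤ)} (hC : IsConeOf C S)
    (T : Finset (Fin d → ℤ)) (hT : ∀ v ∈ T, toQ v ∈ C) (c : (Fin d → ℤ) → ℚ)
    (hc : ∀ v, 0 ≤ c v) : ∑ v ∈ T, c v • toQ v ∈ C := by
  classical
  induction T using Finset.induction_on with
  | empty => rw [hC]; exact ⟨0, fun _ => le_rfl, by simp⟩
  | insert a s ha ih =>
    rw [Finset.sum_insert ha]
    exact cone_add hC (cone_smul hC (hc a) (hT a (by simp)))
      (ih fun v hv => hT v (Finset.mem_insert_of_mem hv))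

theorem mem_Gamma_iff {d : ℕ} {C : Set (Fin d → ℚ)} {S : Finset (Fin d → ℤ)} (hC : IsConeOf C S)
    (m : Fin d → ℤ) : m ∈ GammaC C ↔ ∀ v ∈ S, 0 ≤ dotZ v m := by
  constructor
  · intro h v hv
    have := h _ (gen_mem hC hv)
    rw [dotQ_toQ] at this
    exact_mod_cast this
  · intro h x hx
    rw [hC] at hx
    obtain ⟨c, hc, rfl⟩ := hx
    rw [dotQ_comb]
    exact Finset.sum_nonneg fun v hv => mul_nonneg (hc v) (by exact_mod_cast h v hv)

theorem Gamma_nonneg {d : ℕ} {C : Set (Fin d → ℚ)} {m ρ : Fin d → ℤ} (hm : m ∈ GammaC C)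
    (hρ : toQ ρ ∈ C) : 0 ≤ dotZ ρ m := by
  have := hm _ hρ
  rw [dotQ_toQ] at this
  exact_mod_cast this

theorem bezout_vec {d : ℕ} (v : Fin d → ℤ) :
    ∃ (k : ℤ) (w m : Fin d → ℤ), 0 ≤ k ∧ v = k • w ∧ dotZ v m = k := by
  have key : ∃ (k : ℤ) (w m : Fin d → ℤ), v = k • w ∧ dotZ v m = k := by
    obtain ⟨k, hk⟩ := (IsPrincipalIdealRing.principal (Ideal.span (Set.range v)))
    have hk' : Ideal.span (Set.range v) = Ideal.span {k} := hk
    have h1 : ∀ i, ∃ w, v i = k * w := fun i => by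
      have : v i ∈ Ideal.span {k} := hk' ▸ Ideal.subset_span ⟨i, rfl⟩
      exact Ideal.mem_span_singleton.1 this
    have h2 : k ∈ Ideal.span (Set.range v) := hk' ▸ Ideal.mem_span_singleton_self k
    obtain ⟨m, hm⟩ := Ideal.mem_span_range_iff_exists_fun.1 h2
    choose w hw using h1
    refine ⟨k, w, m, funext hw, ?_⟩
    rw [← hm]
    exact Finset.sum_congr rfl fun i _ => mul_comm _ _
  obtain ⟨k, w, m, h1, h2⟩ := key
  rcases le_total 0 k with h | h
  · exact ⟨k, w, m, h, h1, h2⟩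
  · refine ⟨-k, -w, -m, by linarith, by simpa using h1, ?_⟩
    have := dotZ_smul v (-1) m
    simp at this
    rw [this, h2]

/-- a lattice point in the relative interior of the facet of the dual cone orthogonal to a ray -/
theorem facet_point {d : ℕ} {C : Set (Fin d → ℚ)} {S : Finset (Fin d → ℤ)} (hC : IsConeOf C S)
    {ρ : Fin d → ℤ} (hρ : IsPrimRayGen C ρ) :
    ∃ l ∈ GammaC C, dotZ ρ l = 0 ∧ ∀ v ∈ S, ¬ OnRay ρ (toQ v) → 0 < dotZ v l := by
  classical
  have one : ∀ v ∈ S, ∃ l ∈ GammaC C, dotZ ρ l = 0 ∧ (¬ OnRay ρ (toQ v) → 0 < dotZ v l) := by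
    intro v hv
    by_cases hr : OnRay ρ (toQ v)
    · exact ⟨0, zero_mem _, by simp [dotZ], fun h => (h hr).elim⟩
    let L : (Fin d → ℚ) → ((Fin d → ℚ) →ₗ[ℚ] ℚ) := fun x =>
      ∑ i, x i • LinearMap.proj i
    have hL : ∀ x w, L x w = ∑ i, x i * w i := fun x w => by simp [L]
    have hLs : ∀ x i, L x (Pi.single i 1) = x i := fun x i => by simp [hL, Pi.single_apply]
    let f : Option (Fin d → ℤ) → ((Fin d → ℚ) →ₗ[ℚ] ℚ) := fun o =>
      match o with
      | none => - L (toQ ρ)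
      | some s => L (toQ s)
    have hex : ∃ w, (∀ s ∈ S, 0 ≤ L (toQ s) w) ∧ L (toQ ρ) w ≤ 0 ∧ 0 < L (toQ v) w := by
      by_contra hcon
      push Not at hcon
      obtain ⟨c, hc, hgc⟩ := farkasQ (Finset.insertNone S) f (- L (toQ v)) (by
        intro w hw
        have := hcon w (fun s hs => hw (some s) (by simpa using hs)) (by
          have := hw none (by simp)
          simpa [f] using this)
        simpa using this)
      apply hr
      refine hρ.2.2 _ (gen_mem hC hv) (∑ s ∈ S, c (some s) • toQ s) ?_ ?_
      · rw [hC]; exact ⟨fun s => c (some s), fun s => hc _, rfl⟩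
      · refine ⟨c none, hc _, ?_⟩
        ext i
        have := congrArg (fun g => g (Pi.single i 1)) hgc
        simp [Finset.sum_insertNone, f, hLs] at this
        simp
        linarith
    obtain ⟨w, hw1, hw2, hw3⟩ := hex
    obtain ⟨N, hN⟩ := IsLocalization.exist_integer_multiples (nonZeroDivisors ℤ)
      (Finset.univ : Finset (Fin d)) w
    have hNpos : 0 < |(N : ℤ)| := abs_pos.2 (nonZeroDivisors.coe_ne_zero N)
    have hint : ∃ l : Fin d → ℤ, ∀ i, (l i : ℚ) = ((|(N : ℤ)| : ℤ) : ℚ) * w i := by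
      have : ∀ i, ∃ l : ℤ, (l : ℚ) = ((|(N : ℤ)| : ℤ) : ℚ) * w i := by
        intro i
        obtain ⟨l, hl⟩ := hN i (by simp)
        simp at hl
        rcases abs_choice (N : ℤ) with e | e
        · exact ⟨l, by rw [e, hl]⟩
        · exact ⟨-l, by rw [e]; push_cast; rw [hl]; simp⟩
      choose l hl using this
      exact ⟨l, hl⟩
    obtain ⟨l, hl⟩ := hint
    have hdot : ∀ u : Fin d → ℤ, (dotZ u l : ℚ) = ((|(N : ℤ)| : ℤ) : ℚ) * L (toQ u) w := by
      intro u
      rw [← dotQ_toQ, hL, dotQ, Finset.mul_sum]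
      refine Finset.sum_congr rfl fun i _ => ?_
      rw [hl]; ring
    have hNq : (0 : ℚ) < ((|(N : ℤ)| : ℤ) : ℚ) := by exact_mod_cast hNpos
    have hlG : l ∈ GammaC C := by
      rw [mem_Gamma_iff hC]
      intro s hs
      have : (0 : ℚ) ≤ (dotZ s l : ℚ) := by
        rw [hdot]; exact mul_nonneg hNq.le (hw1 s hs)
      exact_mod_cast this
    refine ⟨l, hlG, ?_, fun _ => ?_⟩
    · refine le_antisymm ?_ (Gamma_nonneg hlG hρ.2.1)
      have : (dotZ ρ l : ℚ) ≤ 0 := by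
        rw [hdot]; exact mul_nonpos_of_nonneg_of_nonpos hNq.le hw2
      exact_mod_cast this
    · have : (0 : ℚ) < (dotZ v l : ℚ) := by
        rw [hdot]; exact mul_pos hNq hw3
      exact_mod_cast this
  choose! l hl1 hl2 hl3 using one
  have hG : ∀ s ∈ S, l s ∈ GammaC C := hl1
  refine ⟨∑ v ∈ S, l v, sum_mem hG, ?_, ?_⟩
  · rw [dotZ_sum]; exact Finset.sum_eq_zero hl2
  · intro v hv hr
    rw [dotZ_sum]
    exact Finset.sum_pos' (fun s hs => Gamma_nonneg (hG s hs) (gen_mem hC hv))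
      ⟨v, hv, hl3 v hv hr⟩

theorem push_in {d : ℕ} {C : Set (Fin d → ℚ)} {S : Finset (Fin d → ℤ)} (hC : IsConeOf C S)
    {ρ l m : Fin d → ℤ} (hl : ∀ v ∈ S, ¬ OnRay ρ (toQ v) → 0 < dotZ v l)
    (hl0 : dotZ ρ l = 0) (hm : 0 ≤ dotZ ρ m) : ∃ N : ℕ, m + N • l ∈ GammaC C := by
  refine ⟨∑ v ∈ S, (dotZ v m).natAbs, ?_⟩
  rw [mem_Gamma_iff hC]
  intro v hv
  rw [dotZ_add, dotZ_nsmul]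
  by_cases hr : OnRay ρ (toQ v)
  · obtain ⟨q, hq, e⟩ := hr
    have h : ∀ n, (dotZ v n : ℚ) = q * dotZ ρ n := by
      intro n
      rw [← dotQ_toQ, ← dotQ_toQ, e]
      simp [dotQ, Finset.mul_sum, mul_assoc]
    have h1 : (0:ℚ) ≤ dotZ v m := by
      rw [h]; exact mul_nonneg hq (by exact_mod_cast hm)
    have h2 : (dotZ v l : ℚ) = 0 := by rw [h, hl0]; simp
    have h1' : 0 ≤ dotZ v m := by exact_mod_cast h1
    have h2' : dotZ v l = 0 := by exact_mod_cast h2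
    rw [h2']; simpa using h1'
  · have h1 := hl v hv hr
    have h2 : (dotZ v m).natAbs ≤ ∑ v ∈ S, (dotZ v m).natAbs :=
      Finset.single_le_sum (f := fun v => (dotZ v m).natAbs) (fun _ _ => Nat.zero_le _) hv
    have h3 : (-(dotZ v m)) ≤ ((∑ v ∈ S, (dotZ v m).natAbs : ℕ) : ℤ) := by
      have : (((dotZ v m).natAbs : ℕ) : ℤ) ≤ ((∑ v ∈ S, (dotZ v m).natAbs : ℕ) : ℤ) := by
        exact_mod_cast h2
      omega
    nlinarith

theorem prim_eq {d : ℕ} {ρ ρ' : Fin d → ℤ}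
    (h : ∀ (k : ℤ) (w : Fin d → ℤ), ρ = k • w → IsUnit k)
    (h' : ∀ (k : ℤ) (w : Fin d → ℤ), ρ' = k • w → IsUnit k)
    {p q : ℤ} (hp : 0 < p) (hq : 0 < q) (e : p • ρ = q • ρ') : ρ = ρ' := by
  obtain ⟨k, w, m, hk, h1, h2⟩ := bezout_vec ρ
  obtain ⟨k', w', m', hk', h1', h2'⟩ := bezout_vec ρ'
  have hk1 : k = 1 := by
    have := Int.isUnit_iff.1 (h k w h1); omega
  have hk1' : k' = 1 := by
    have := Int.isUnit_iff.1 (h' k' w' h1'); omega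
  subst hk1 hk1'
  have e1 : p = q * dotZ ρ' m := by
    rw [← smul_dotZ, ← e, smul_dotZ, h2, mul_one]
  have e2 : q = p * dotZ ρ m' := by
    rw [← smul_dotZ, e, smul_dotZ, h2', mul_one]
  have hpq : p = q := Int.dvd_antisymm hp.le hq.le ⟨_, e2⟩ ⟨_, e1⟩
  subst hpq
  exact smul_right_injective _ hp.ne' e

theorem exists_ray {d : ℕ} {C : Set (Fin d → ℚ)} {S : Finset (Fin d → ℤ)} (hC : IsConeOf C S)
    (hconv : StrictConvexCone C) {μ : Fin d → ℤ} (hμ : μ ∉ GammaC C) :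
    ∃ ρ, IsPrimRayGen C ρ ∧ dotZ ρ μ < 0 := by
  classical
  -- a generating set of minimal cardinality
  have hex : ∃ n, ∃ T : Finset (Fin d → ℤ), IsConeOf C T ∧ T.card = n := ⟨_, S, hC, rfl⟩
  obtain ⟨T, hT, hTc⟩ := Nat.find_spec hex
  have hmin : ∀ T' : Finset (Fin d → ℤ), IsConeOf C T' → T.card ≤ T'.card := fun T' h => by
    rw [hTc]; exact Nat.find_min' hex ⟨T', h, rfl⟩
  rw [mem_Gamma_iff hT] at hμ
  push Not at hμ
  obtain ⟨v, hv, hvμ⟩ := hμ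
  have hv0 : v ≠ 0 := by rintro rfl; simp [dotZ] at hvμ
  -- no generator is redundant
  have hred : ∀ u ∈ T, ∀ c : (Fin d → ℤ) → ℚ, (∀ x, 0 ≤ c x) →
      toQ u ≠ ∑ x ∈ T.erase u, c x • toQ x := by
    intro u hu c hc e
    have h : IsConeOf C (T.erase u) := by
      have h2 : ∀ x, x ∈ C ↔ ∃ a : (Fin d → ℤ) → ℚ, (∀ v, 0 ≤ a v) ∧
          x = ∑ v ∈ T, a v • toQ v := fun x => by rw [hT]; rfl
      unfold IsConeOf
      ext x
      rw [h2]
      constructor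
      · rintro ⟨a, ha, rfl⟩
        refine ⟨fun y => a y + a u * c y, fun y => add_nonneg (ha y) (mul_nonneg (ha u) (hc y)), ?_⟩
        rw [← Finset.add_sum_erase T _ hu, e, Finset.smul_sum, ← Finset.sum_add_distrib]
        refine Finset.sum_congr rfl fun y _ => ?_
        rw [add_smul, smul_smul, add_comm]
      · rintro ⟨a, ha, rfl⟩
        refine ⟨fun y => if y = u then 0 else a y, fun y => by
          dsimp only; split_ifs; exacts [le_rfl, ha y], ?_⟩
        rw [← Finset.add_sum_erase T _ hu]
        simp only [if_true, zero_smul, zero_add]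
        refine Finset.sum_congr rfl fun y hy => ?_
        rw [if_neg (Finset.ne_of_mem_erase hy)]
    have := hmin _ h
    rw [Finset.card_erase_of_mem hu] at this
    have := Finset.card_pos.2 ⟨u, hu⟩
    omega
  have hne : ∀ u ∈ T, toQ u ≠ 0 := fun u hu e =>
    hred u hu 0 (fun _ => le_rfl) (by simp [e])
  -- extremality of `v`
  have hext : ∀ x ∈ C, ∀ y ∈ C, OnRay v (x + y) → OnRay v x := by
    intro x hx y hy ⟨q, hq, e⟩
    rw [hT] at hx hy
    obtain ⟨a, ha, rfl⟩ := hx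
    obtain ⟨b, hb, rfl⟩ := hy
    have e2 : ∑ u ∈ T.erase v, (a u + b u) • toQ u = (q - a v - b v) • toQ v := by
      rw [← Finset.add_sum_erase T _ hv, ← Finset.add_sum_erase T _ hv] at e
      simp only [add_smul, Finset.sum_add_distrib, sub_smul]
      rw [← e]; abel
    by_cases hpos : 0 < q - a v - b v
    · exfalso
      refine hred v hv (fun u => (q - a v - b v)⁻¹ * (a u + b u))
        (fun u => mul_nonneg (inv_nonneg.2 hpos.le) (add_nonneg (ha u) (hb u))) ?_
      simp only [mul_smul, ← Finset.smul_sum]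
      rw [e2, smul_smul, inv_mul_cancel₀ hpos.ne', one_smul]
    · push Not at hpos
      have hz : ∀ u ∈ T.erase v, a u = 0 := by
        intro u hu
        have huT := Finset.mem_of_mem_erase hu
        have hz1 : (a u + b u) • toQ u = 0 := by
          refine hconv _ (cone_smul hT (add_nonneg (ha u) (hb u)) (gen_mem hT huT)) ?_
          have : -((a u + b u) • toQ u) = ∑ z ∈ (T.erase v).erase u, (a z + b z) • toQ z
              + (-(q - a v - b v)) • toQ v := by
            rw [neg_smul, ← e2, ← Finset.add_sum_erase (T.erase v) _ hu]; abel
          rw [this]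
          refine cone_add hT (cone_sum hT _ (fun z hz => gen_mem hT
            (Finset.mem_of_mem_erase (Finset.mem_of_mem_erase hz))) (fun z => a z + b z)
            (fun z => add_nonneg (ha z) (hb z))) (cone_smul hT (by linarith) (gen_mem hT hv))
        rcases smul_eq_zero.1 hz1 with h | h
        · linarith [ha u, hb u]
        · exact (hne u huT h).elim
      refine ⟨a v, ha v, ?_⟩
      rw [← Finset.add_sum_erase T _ hv, Finset.sum_eq_zero (fun u hu => by rw [hz u hu, zero_smul]),
        add_zero]
  obtain ⟨k, w, m, hk, hvw, hvm⟩ := bezout_vec v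
  have hkpos : 0 < k := by
    refine lt_of_le_of_ne hk fun h => hv0 ?_
    rw [hvw, ← h, zero_smul]
  have hkq : (0 : ℚ) < k := by exact_mod_cast hkpos
  have hvq : toQ v = (k : ℚ) • toQ w := by
    rw [hvw]; ext i; simp [toQ]
  have hwq : toQ w = (k : ℚ)⁻¹ • toQ v := by
    rw [hvq, smul_smul, inv_mul_cancel₀ hkq.ne', one_smul]
  refine ⟨w, ⟨?_, ?_, ?_⟩, ?_⟩
  · intro j u hju
    have : k * 1 = k * (j * dotZ u m) := by
      rw [← smul_dotZ, ← hju, ← smul_dotZ, ← hvw, hvm, mul_one]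
    exact IsUnit.of_mul_eq_one _ (mul_left_cancel₀ hkpos.ne' this).symm
  · rw [hwq]; exact cone_smul hT (inv_nonneg.2 hkq.le) (gen_mem hT hv)
  · intro x hx y hy ⟨q, hq, e⟩
    obtain ⟨r, hr, e'⟩ := hext x hx y hy
      ⟨q * (k : ℚ)⁻¹, mul_nonneg hq (inv_nonneg.2 hkq.le), by rw [e, hwq, smul_smul]⟩
    exact ⟨r * k, mul_nonneg hr hkq.le, by rw [e', hvq, smul_smul]⟩
  · rw [hvw, smul_dotZ] at hvμ
    nlinarith

/-- If a nonzero derivation of the monoid algebra `A(C)` is homogeneous of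
degree `μ` and locally nilpotent, then `μ` is a Demazure root of `C`. (Here `Γ(C)` is
assumed to generate the lattice `M` as a group, which expresses strict convexity of `C`.) -/
theorem homogeneous_lnd_degree_is_demazure_root {K : Type*} [Field K] [CharZero K]
    [IsAlgClosed K] {d : ℕ}
    (C : Set (Fin d → ℚ)) (S : Finset (Fin d → ℤ)) (hC : IsConeOf C S)
    (hconv : StrictConvexCone C)
    (hgen : ∀ m : Fin d → ℤ, ∃ a ∈ GammaC C, ∃ b ∈ GammaC C, m = a - b)
    (μ : Fin d → ℤ)
    (D : Derivation K (AddMonoidAlgebra K (GammaC C)) (AddMonoidAlgebra K (GammaC C)))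
    (hD0 : D ≠ 0)
    (hhom : ∀ (lam : Fin d → ℤ) (hlam : lam ∈ GammaC C) (h2 : lam + μ ∈ GammaC C),
      ∃ c : K, D (AddMonoidAlgebra.single ⟨lam, hlam⟩ 1) =
        c • AddMonoidAlgebra.single ⟨lam + μ, h2⟩ 1)
    (hhom' : ∀ (lam : Fin d → ℤ) (hlam : lam ∈ GammaC C), lam + μ ∉ GammaC C →
      D (AddMonoidAlgebra.single ⟨lam, hlam⟩ 1) = 0)
    (hln : ∀ a : AddMonoidAlgebra K (GammaC C), ∃ n : ℕ, (D.toLinearMap ^ n) a = 0) :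
    ∃ ρ : Fin d → ℤ, IsDemazureRoot C ρ μ := by
  classical
  -- the coefficient function of `D`
  have hcex : ∀ g : GammaC C, ∃ c : K,
      (∀ h : (g : Fin d → ℤ) + μ ∈ GammaC C,
        D (AddMonoidAlgebra.single g 1) = AddMonoidAlgebra.single ⟨g + μ, h⟩ c) ∧
      ((g : Fin d → ℤ) + μ ∉ GammaC C → c = 0) := by
    intro g
    by_cases h : (g : Fin d → ℤ) + μ ∈ GammaC C
    · obtain ⟨c, hc⟩ := hhom g g.2 h
      refine ⟨c, fun _ => ?_, fun h' => (h' h).elim⟩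
      rw [AddMonoidAlgebra.smul_single, smul_eq_mul, mul_one] at hc
      exact hc
    · exact ⟨0, fun h' => (h h').elim, fun _ => rfl⟩
  choose c hc1 hc0 using hcex
  have hcadd : ∀ g h : GammaC C, c (g + h) = c g + c h := by
    intro g h
    by_cases hgh : ((g + h : GammaC C) : Fin d → ℤ) + μ ∈ GammaC C
    · have e := hc1 _ hgh
      have hprod : (AddMonoidAlgebra.single (g + h) 1 : AddMonoidAlgebra K (GammaC C)) =
          AddMonoidAlgebra.single g 1 * AddMonoidAlgebra.single h 1 := by
        rw [AddMonoidAlgebra.single_mul_single, mul_one]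
      have key : ∀ g h : GammaC C, ∀ hgh : ((g + h : GammaC C) : Fin d → ℤ) + μ ∈ GammaC C,
          (AddMonoidAlgebra.single g 1 : AddMonoidAlgebra K (GammaC C)) *
            D (AddMonoidAlgebra.single h 1) =
          AddMonoidAlgebra.single ⟨((g + h : GammaC C) : Fin d → ℤ) + μ, hgh⟩ (c h) := by
        intro g h hgh
        by_cases hh : (h : Fin d → ℤ) + μ ∈ GammaC C
        · rw [hc1 h hh, AddMonoidAlgebra.single_mul_single, one_mul]
          congr 1
          apply Subtype.ext
          simp [add_assoc]
        · have : D (AddMonoidAlgebra.single h 1) = 0 := hhom' h h.2 hh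
          rw [this, hc0 h hh]
          simp
      have hhg : ((h + g : GammaC C) : Fin d → ℤ) + μ ∈ GammaC C := by
        rw [add_comm h g]; exact hgh
      have k1 := key g h hgh
      have k2 := key h g hhg
      have hpt : (⟨((h + g : GammaC C) : Fin d → ℤ) + μ, hhg⟩ : GammaC C) =
          ⟨((g + h : GammaC C) : Fin d → ℤ) + μ, hgh⟩ := by
        apply Subtype.ext
        simp [add_comm]
      rw [hpt] at k2
      rw [hprod, Derivation.leibniz, smul_eq_mul, smul_eq_mul, k1, k2,
        ← AddMonoidAlgebra.single_add] at e
      have := AddMonoidAlgebra.single_right_injective e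
      rw [← this, add_comm]
    · have hg : (g : Fin d → ℤ) + μ ∉ GammaC C := fun hg => hgh (by
        have := add_mem h.2 hg
        convert this using 1
        simp; abel)
      have hh : (h : Fin d → ℤ) + μ ∉ GammaC C := fun hg => hgh (by
        have := add_mem g.2 hg
        convert this using 1
        simp; abel)
      rw [hc0 _ hgh, hc0 _ hg, hc0 _ hh, add_zero]
  have hczero : c 0 = 0 := by
    have := hcadd 0 0
    simpa using this
  have hcn : ∀ (n : ℕ) (g : GammaC C), c (n • g) = n * c g := by
    intro n g
    induction n with
    | zero => simp [hczero]
    | succ n ih => rw [succ_nsmul, hcadd, ih]; push_cast; ring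
  -- some coefficient is nonzero
  have hcne : ∃ g, c g ≠ 0 := by
    by_contra hcon
    push Not at hcon
    apply hD0
    have hs : ∀ g : GammaC C, D (AddMonoidAlgebra.single g 1) = 0 := by
      intro g
      by_cases h : (g : Fin d → ℤ) + μ ∈ GammaC C
      · rw [hc1 g h, hcon g]; simp
      · exact hhom' g g.2 h
    ext1 x
    induction x using AddMonoidAlgebra.induction_linear with
    | zero => simp
    | add x y hx hy => rw [map_add, map_add, hx, hy]
    | single m r =>
      have : (AddMonoidAlgebra.single m r : AddMonoidAlgebra K (GammaC C)) =
          r • AddMonoidAlgebra.single m 1 := by simp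
      rw [this, D.map_smul, hs]; simp
  obtain ⟨g0, hg0⟩ := hcne
  -- local nilpotency forces `μ ∉ Γ(C)`
  have hμ : μ ∉ GammaC C := by
    intro hμ
    have hiter : ∀ g : GammaC C, (∀ i : ℕ, c (g + i • ⟨μ, hμ⟩) ≠ 0) → False := by
      intro g hg
      have : ∀ n : ℕ, ∃ r : K, r ≠ 0 ∧ (D.toLinearMap ^ n) (AddMonoidAlgebra.single g 1) =
          AddMonoidAlgebra.single (g + n • (⟨μ, hμ⟩ : GammaC C)) r := by
        intro n
        induction n with
        | zero => exact ⟨1, one_ne_zero, by simp⟩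
        | succ n ih =>
          obtain ⟨r, hr, e⟩ := ih
          refine ⟨r * c (g + n • ⟨μ, hμ⟩), mul_ne_zero hr (hg n), ?_⟩
          rw [pow_succ', Module.End.mul_apply, e]
          have h1 : (AddMonoidAlgebra.single (g + n • (⟨μ, hμ⟩ : GammaC C)) r :
              AddMonoidAlgebra K (GammaC C)) =
              r • AddMonoidAlgebra.single (g + n • (⟨μ, hμ⟩ : GammaC C)) 1 := by simp
          have h2 : ((g + n • (⟨μ, hμ⟩ : GammaC C) : GammaC C) : Fin d → ℤ) + μ ∈ GammaC C :=
            add_mem (g + n • (⟨μ, hμ⟩ : GammaC C)).2 hμ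
          rw [h1, map_smul]
          change r • D _ = _
          rw [hc1 _ h2, AddMonoidAlgebra.smul_single, smul_eq_mul]
          congr 1
          apply Subtype.ext
          simp [succ_nsmul, add_assoc]
          try ring
      obtain ⟨n, hn⟩ := hln (AddMonoidAlgebra.single g 1)
      obtain ⟨r, hr, e⟩ := this n
      rw [hn] at e
      exact hr (AddMonoidAlgebra.single_eq_zero.1 e.symm)
    by_cases hcμ : c ⟨μ, hμ⟩ = 0
    · refine hiter g0 fun i => ?_
      rw [hcadd, hcn, hcμ]
      simpa using hg0
    · refine hiter ⟨μ, hμ⟩ fun i => ?_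
      rw [hcadd, hcn]
      have : c ⟨μ, hμ⟩ + i * c ⟨μ, hμ⟩ = ((i + 1 : ℕ) : K) * c ⟨μ, hμ⟩ := by push_cast; ring
      rw [this]
      exact mul_ne_zero (Nat.cast_ne_zero.2 (Nat.succ_ne_zero i)) hcμ
  -- vanishing on the facet orthogonal to a negative ray
  have hvan : ∀ ρ, IsPrimRayGen C ρ → dotZ ρ μ < 0 → ∀ g : GammaC C, dotZ ρ g = 0 → c g = 0 := by
    intro ρ hρ hneg g hg
    refine hc0 g fun h => ?_
    have := Gamma_nonneg h hρ.2.1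
    rw [dotZ_add] at this
    omega
  have hprop : ∀ ρ, IsPrimRayGen C ρ → dotZ ρ μ < 0 → ∀ g h : GammaC C,
      c g * (dotZ ρ h : K) = c h * (dotZ ρ g : K) := by
    intro ρ hρ hneg g h
    obtain ⟨l, hl, hl0, hlpos⟩ := facet_point hC hρ
    obtain ⟨a, ha⟩ := Int.eq_ofNat_of_zero_le (Gamma_nonneg h.2 hρ.2.1)
    obtain ⟨b, hb⟩ := Int.eq_ofNat_of_zero_le (Gamma_nonneg g.2 hρ.2.1)
    have hm0 : dotZ ρ (a • (g : Fin d → ℤ) - b • (h : Fin d → ℤ)) = 0 := by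
      rw [dotZ_sub, dotZ_nsmul, dotZ_nsmul, ha, hb]; ring
    obtain ⟨N, hN⟩ := push_in hC hlpos hl0 hm0.ge
    have e : a • g + N • (⟨l, hl⟩ : GammaC C) = ⟨_, hN⟩ + b • h := by
      apply Subtype.ext
      simp only [AddSubmonoid.coe_add, AddSubmonoidClass.coe_nsmul]
      abel
    have e2 := congrArg c e
    rw [hcadd, hcadd, hcn, hcn, hcn, hvan ρ hρ hneg ⟨l, hl⟩ hl0,
      hvan ρ hρ hneg ⟨_, hN⟩ (by
        show dotZ ρ (_ + _) = 0
        rw [dotZ_add, dotZ_nsmul, hm0, hl0]; ring)] at e2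
    rw [ha, hb]
    push_cast
    linear_combination e2
  obtain ⟨ρ, hρ, hneg⟩ := exists_ray hC hconv hμ
  have hpos : ∀ ρ, IsPrimRayGen C ρ → dotZ ρ μ < 0 → 0 < dotZ ρ g0 := by
    intro ρ hρ hneg
    refine lt_of_le_of_ne (Gamma_nonneg g0.2 hρ.2.1) fun h => hg0 (hvan ρ hρ hneg g0 h.symm)
  refine ⟨ρ, hρ, ?_, ?_⟩
  · obtain ⟨k, w, m, hk, h1, h2⟩ := bezout_vec ρ
    have hk1 : k = 1 := by
      have := Int.isUnit_iff.1 (hρ.1 k w h1); omega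
    subst hk1
    obtain ⟨l, hl, hl0, hlpos⟩ := facet_point hC hρ
    obtain ⟨N, hN⟩ := push_in hC hlpos hl0 (m := m) (by rw [h2]; exact hk)
    have hν : dotZ ρ (m + N • l) = 1 := by rw [dotZ_add, dotZ_nsmul, h2, hl0]; ring
    have hcν : c ⟨_, hN⟩ ≠ 0 := by
      intro h0
      have := hprop ρ hρ hneg g0 ⟨_, hN⟩
      rw [h0] at this
      change c g0 * ((dotZ ρ (m + N • l) : ℤ) : K) = _ at this
      rw [hν, Int.cast_one, mul_one, zero_mul] at this
      exact hg0 this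
    have hmem : (m + N • l) + μ ∈ GammaC C := by
      by_contra h
      exact hcν (hc0 ⟨_, hN⟩ h)
    have := Gamma_nonneg hmem hρ.2.1
    rw [dotZ_add, hν] at this
    omega
  · intro ρ' hρ' hne
    by_contra hneg'
    push Not at hneg'
    apply hne
    have hp := hpos ρ hρ hneg
    have hp' := hpos ρ' hρ' hneg'
    have hG : ∀ g ∈ GammaC C, dotZ ρ g0 * dotZ ρ' g = dotZ ρ' g0 * dotZ ρ g := by
      intro g hg
      have e1 := hprop ρ hρ hneg g0 ⟨g, hg⟩
      have e2 := hprop ρ' hρ' hneg' g0 ⟨g, hg⟩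
      have : c g0 * ((dotZ ρ g0 : K) * dotZ ρ' g) = c g0 * ((dotZ ρ' g0 : K) * dotZ ρ g) := by
        linear_combination (dotZ ρ g0 : K) * e2 - (dotZ ρ' g0 : K) * e1
      exact_mod_cast mul_left_cancel₀ hg0 this
    refine prim_eq hρ'.1 hρ.1 hp hp' ?_
    ext i
    obtain ⟨a, ha, b, hb, e⟩ := hgen (Pi.single i 1)
    have hs : ∀ v : Fin d → ℤ, v i = dotZ v a - dotZ v b := by
      intro v
      rw [← dotZ_sub, ← e]
      simp [dotZ, Pi.single_apply]
    simp only [Pi.smul_apply, smul_eq_mul]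
    rw [hs ρ', hs ρ]
    linear_combination hG a ha - hG b hb
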